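/- Let A be a finite algebra, ρ, σ ∈ Con*(A), L ∈ Cov(ρ), and R ∈ Cov(σ). If there exists a reflexive bridge from (A,ρ,L) to (A,σ,R), then Opt(ρ,L) = Opt(σ,R). -/

import Mathlib

namespace Zhuk

/-- A signature: a type of operation symbols with arities. -/
structure Signature where
  ops : Type
  arity : ops → ℕ

/-- An algebra structure of signature `S` on carrier `A`. -/
class SAlg (S : Signature) (A : Type) where
  interp : (o : S.ops) → (Fin (S.arity o) → A) → A

variable {S : Signature}

/-- Componentwise algebra structure on a product. -/
instance prodSAlg {A B : Type} [SAlg S A] [SAlg S B] : SAlg S (A × B) :=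
  ⟨fun o x => (SAlg.interp o fun i => (x i).1, SAlg.interp o fun i => (x i).2)⟩

/-- A subset closed under all the operations. -/
def IsSubuniverse (S : Signature) {A : Type} [SAlg S A] (R : Set A) : Prop :=
  ∀ (o : S.ops) (x : Fin (S.arity o) → A), (∀ i, x i ∈ R) → SAlg.interp o x ∈ R

/-- The algebra structure on (the subtype of) a subuniverse. -/
def subAlg {A : Type} [SAlg S A] (R : Set A) (h : IsSubuniverse S R) : SAlg S ↥R :=
  ⟨fun o x => ⟨SAlg.interp o fun i => (x i).1, h o _ fun i => (x i).2⟩⟩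

/-- Terms of signature `S` in `n` variables. -/
inductive STerm (S : Signature) (n : ℕ) : Type
  | var : Fin n → STerm S n
  | app (o : S.ops) : (Fin (S.arity o) → STerm S n) → STerm S n

/-- Evaluation of a term in an algebra. -/
def STerm.eval {A : Type} [SAlg S A] {n : ℕ} : STerm S n → (Fin n → A) → A
  | .var i, v => v i
  | .app o ts, v => SAlg.interp o fun i => (ts i).eval v

/-- The diagonal (smallest) congruence `0_A`. -/
def diag (A : Type) : Set (A × A) := {p | p.1 = p.2}

/-- Relational composition. -/
def rcomp {A B C : Type} (R : Set (A × B)) (T : Set (B × C)) : Set (A × C) :=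
  {p | ∃ b, (p.1, b) ∈ R ∧ (b, p.2) ∈ T}

/-- Relational inverse. -/
def rinv {A B : Type} (R : Set (A × B)) : Set (B × A) := {p | (p.2, p.1) ∈ R}

/-- Transitive closure of a binary relation (as a set of pairs). -/
def transCl {A : Type} (R : Set (A × A)) : Set (A × A) :=
  {p | Relation.TransGen (fun a b => (a, b) ∈ R) p.1 p.2}

/-- `R` is stable under (saturated with respect to) `ρ`:  `R = ρ ∘ R ∘ ρ`. -/
def Saturated {A : Type} (ρ R : Set (A × A)) : Prop := rcomp ρ (rcomp R ρ) = R

/-- A congruence: a subuniverse of `A²` which is an equivalence relation. -/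
def IsCongruence (S : Signature) {A : Type} [SAlg S A] (θ : Set (A × A)) : Prop :=
  IsSubuniverse S θ ∧ Equivalence fun a b => (a, b) ∈ θ

/-- `ρ ∈ Con*(A)`: a congruence different from the full congruence `1_A`. -/
def ConStar (S : Signature) {A : Type} [SAlg S A] (ρ : Set (A × A)) : Prop :=
  IsCongruence S ρ ∧ ρ ≠ Set.univ

/-- The ternary centralizer relation `C(φ, θ; δ)`, via the term condition. -/
def Centralizes (S : Signature) {A : Type} [SAlg S A] (φ θ δ : Set (A × A)) : Prop :=
  ∀ (n : ℕ) (t : STerm S (n + 1)) (a b : A) (c d : Fin n → A),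
    (a, b) ∈ φ → (∀ i, (c i, d i) ∈ θ) →
    (t.eval (Fin.cons a c), t.eval (Fin.cons a d)) ∈ δ →
    (t.eval (Fin.cons b c), t.eval (Fin.cons b d)) ∈ δ

/-- The centralizer `(δ : θ)`: the largest congruence `φ` with `C(φ, θ; δ)`. -/
def centralizer (S : Signature) {A : Type} [SAlg S A] (δ θ : Set (A × A)) : Set (A × A) :=
  ⋃₀ {φ | IsCongruence S φ ∧ Centralizes S φ θ δ}

/-- A congruence of the subalgebra `A(θ) ≤ A²`, viewed ambiently as a subset of
`(A×A) × (A×A)` whose field is `θ`. -/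
def IsConOn (S : Signature) {A : Type} [SAlg S A] (θ : Set (A × A))
    (Δ : Set ((A × A) × (A × A))) : Prop :=
  Δ ⊆ θ ×ˢ θ ∧ IsSubuniverse S Δ ∧ (∀ p ∈ θ, (p, p) ∈ Δ) ∧
    (∀ p q, (p, q) ∈ Δ → (q, p) ∈ Δ) ∧ (∀ p q r, (p, q) ∈ Δ → (q, r) ∈ Δ → (p, r) ∈ Δ)

/-- `Δ_{θ,α}`: the congruence of `A(θ)` generated by `{((a,a),(b,b)) : (a,b) ∈ α}`. -/
def DeltaCon (S : Signature) {A : Type} [SAlg S A] (θ α : Set (A × A)) :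
    Set ((A × A) × (A × A)) :=
  ⋂₀ {Δ | IsConOn S θ Δ ∧ ∀ a b : A, (a, b) ∈ α → ((a, a), (b, b)) ∈ Δ}

/-- Projection of a quaternary relation to its first two coordinates. -/
def pr12 {A B : Type} (T : Set (A × A × B × B)) : Set (A × A) :=
  {p | ∃ b₁ b₂, (p.1, p.2, b₁, b₂) ∈ T}

/-- Projection of a quaternary relation to its last two coordinates. -/
def pr34 {A B : Type} (T : Set (A × A × B × B)) : Set (B × B) :=
  {q | ∃ a₁ a₂, (a₁, a₂, q.1, q.2) ∈ T}

/-- The trace of a quaternary relation. -/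
def btr {A B : Type} (T : Set (A × A × B × B)) : Set (A × B) :=
  {p | (p.1, p.1, p.2, p.2) ∈ T}

/-- Zhuk's bridges: Definition 4.3 (B0*), (B1*), (B2*). -/
def IsBridge (S : Signature) {A B : Type} [SAlg S A] [SAlg S B]
    (ρ : Set (A × A)) (σ : Set (B × B)) (T : Set (A × A × B × B)) : Prop :=
  IsSubuniverse S T ∧
  (∀ a₁ a₂ b₁ b₂ a₁' a₂', (a₁, a₂, b₁, b₂) ∈ T → (a₁, a₁') ∈ ρ → (a₂, a₂') ∈ ρ →
    (a₁', a₂', b₁, b₂) ∈ T) ∧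
  (∀ a₁ a₂ b₁ b₂ b₁' b₂', (a₁, a₂, b₁, b₂) ∈ T → (b₁, b₁') ∈ σ → (b₂, b₂') ∈ σ →
    (a₁, a₂, b₁', b₂') ∈ T) ∧
  ρ ⊂ pr12 T ∧ σ ⊂ pr34 T ∧
  (∀ a₁ a₂ b₁ b₂, (a₁, a₂, b₁, b₂) ∈ T → ((a₁, a₂) ∈ ρ ↔ (b₁, b₂) ∈ σ))

/-- A bridge from `(A,ρ,L)` to `(B,σ,R)`: a bridge with prescribed anchors. -/
def IsBridgeLR (S : Signature) {A B : Type} [SAlg S A] [SAlg S B]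
    (ρ : Set (A × A)) (σ : Set (B × B)) (L : Set (A × A)) (R : Set (B × B))
    (T : Set (A × A × B × B)) : Prop :=
  IsBridge S ρ σ T ∧ pr12 T = L ∧ pr34 T = R

/-- A reflexive bridge (case `B = A`): `0_A ⊆ tr(T)`. -/
def ReflBridge {A : Type} (T : Set (A × A × A × A)) : Prop :=
  ∀ a : A, (a, a) ∈ btr T

/-- `Cov(ρ)`: the inclusion-minimal ρ-saturated subuniverses of `A²` properly containing ρ. -/
def Cov (S : Signature) {A : Type} [SAlg S A] (ρ : Set (A × A)) : Set (Set (A × A)) :=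
  {L | IsSubuniverse S L ∧ Saturated ρ L ∧ ρ ⊂ L ∧
    ∀ L', IsSubuniverse S L' → Saturated ρ L' → ρ ⊂ L' → L' ⊆ L → L' = L}

/-- `ref.tr(ρ,L)`: traces of reflexive bridges from `(A,ρ,L)` to itself. -/
def refTr (S : Signature) {A : Type} [SAlg S A] (ρ L : Set (A × A)) : Set (Set (A × A)) :=
  {γ | ∃ T : Set (A × A × A × A), IsBridgeLR S ρ ρ L L T ∧ ReflBridge T ∧ btr T = γ}

/-- `γ = Opt(ρ,L)`: `γ` is the (unique) inclusion-maximal member of `ref.tr(ρ,L)`. -/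
def IsOptOf (S : Signature) {A : Type} [SAlg S A] (ρ L γ : Set (A × A)) : Prop :=
  γ ∈ refTr S ρ L ∧ ∀ δ ∈ refTr S ρ L, γ ⊆ δ → δ = γ

/-- `ρ` is meet-irreducible with unique upper cover `ρplus`. -/
def MeetIrredWith (S : Signature) {A : Type} [SAlg S A] (ρ ρplus : Set (A × A)) : Prop :=
  IsCongruence S ρ ∧ ρ ≠ Set.univ ∧ IsCongruence S ρplus ∧ ρ ⊂ ρplus ∧
    ∀ θ, IsCongruence S θ → ρ ⊂ θ → ρplus ⊆ θ

/-- `Cov⁺(ρ) = {τ ∈ Cov(ρ) : τ ⊆ ρ⁺}`. -/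
def CovPlus (S : Signature) {A : Type} [SAlg S A] (ρ ρplus : Set (A × A)) :
    Set (Set (A × A)) :=
  {τ | τ ∈ Cov S ρ ∧ τ ⊆ ρplus}

/-- A good bridge between meet-irreducible congruences with upper covers `ρplus`, `σplus`. -/
def GoodBridge (S : Signature) {A B : Type} [SAlg S A] [SAlg S B]
    (ρ ρplus : Set (A × A)) (σ σplus : Set (B × B)) (T : Set (A × A × B × B)) : Prop :=
  IsBridge S ρ σ T ∧
    ∃ τ ∈ CovPlus S ρ ρplus, ∃ τ' ∈ CovPlus S σ σplus, ∃ T' ⊆ T,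
      IsBridgeLR S ρ σ τ τ' T' ∧ btr T' = btr T

/-- `t` (with Taylor-identity data `u v`) is idempotent on `A` and satisfies the
corresponding identities on `A`. -/
def TaylorOn (S : Signature) (A : Type) [SAlg S A] {n : ℕ} (t : STerm S n)
    (u v : Fin n → Fin n → Fin 2) : Prop :=
  (∀ a : A, t.eval (fun _ => a) = a) ∧
    ∀ (i : Fin n) (x y : A),
      t.eval (fun j => if u i j = 0 then x else y) =
        t.eval (fun j => if v i j = 0 then x else y)

/-- `A` is a Taylor algebra. -/
def IsTaylorAlg (S : Signature) (A : Type) [SAlg S A] : Prop :=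
  ∃ (n : ℕ) (t : STerm S n) (u v : Fin n → Fin n → Fin 2),
    1 < n ∧ (∀ i, u i i ≠ v i i) ∧ TaylorOn S A t u v

/-- `A` and `B` lie in a common (locally finite, as they are finite) Taylor variety:
they share a common Taylor term with common Taylor identities. -/
def CommonTaylor (S : Signature) (A B : Type) [SAlg S A] [SAlg S B] : Prop :=
  ∃ (n : ℕ) (t : STerm S n) (u v : Fin n → Fin n → Fin 2),
    1 < n ∧ (∀ i, u i i ≠ v i i) ∧ TaylorOn S A t u v ∧ TaylorOn S B t u v

/-- The quotient of `A` by (the equivalence relation of) `θ`. -/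
abbrev ConQuot {A : Type} (θ : Set (A × A)) : Type :=
  Quot (fun a b => (a, b) ∈ θ)

/-- The class of `a` in `A/θ`. -/
def ConQuot.mk {A : Type} (θ : Set (A × A)) (a : A) : ConQuot θ :=
  Quot.mk _ a

/-- The quotient algebra structure on `A/θ` (extensionally correct when `θ` is a
congruence). -/
noncomputable def quotAlg {S : Signature} {A : Type} (iA : SAlg S A) (θ : Set (A × A)) :
    SAlg S (ConQuot θ) :=
  ⟨fun o x => ConQuot.mk θ
    (@SAlg.interp S A iA o fun i => Classical.choose (Quot.exists_rep (x i)))⟩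

/-- `f` is a homomorphism with respect to the given algebra structures. -/
def IsHomI {S : Signature} {A B : Type} (iA : SAlg S A) (iB : SAlg S B) (f : A → B) : Prop :=
  ∀ (o : S.ops) (x : Fin (S.arity o) → A),
    f (@SAlg.interp S A iA o x) = @SAlg.interp S B iB o fun i => f (x i)

/-- The two algebras are isomorphic. -/
def IsoAlgI {S : Signature} {A B : Type} (iA : SAlg S A) (iB : SAlg S B) : Prop :=
  ∃ f : A ≃ B, IsHomI iA iB f

/-- The identity bridge `I_{(A,ρ,L)}`. -/
def idBridge {A : Type} (ρ L : Set (A × A)) : Set (A × A × A × A) :=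
  {p | (p.1, p.2.1) ∈ L ∧ (p.2.2.1, p.2.2.2) ∈ L ∧ (p.1, p.2.2.1) ∈ ρ ∧ (p.2.1, p.2.2.2) ∈ ρ}

/-- Composition of quaternary relations (bridges). -/
def bComp {A B C : Type} (T : Set (A × A × B × B)) (T' : Set (B × B × C × C)) :
    Set (A × A × C × C) :=
  {p | ∃ b₁ b₂, (p.1, p.2.1, b₁, b₂) ∈ T ∧ (b₁, b₂, p.2.2.1, p.2.2.2) ∈ T'}

/-- Converse of a quaternary relation (bridge). -/
def bConv {A B : Type} (T : Set (A × A × B × B)) : Set (B × B × A × A) :=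
  {p | (p.2.2.1, p.2.2.2, p.1, p.2.1) ∈ T}

/-- `Δ♭_{θ,α}`: the congruence `Δ_{θ,α}` of `A(θ)` viewed as a quaternary relation. -/
def deltaFlat (S : Signature) {A : Type} [SAlg S A] (θ α : Set (A × A)) :
    Set (A × A × A × A) :=
  {p | ((p.1, p.2.1), (p.2.2.1, p.2.2.2)) ∈ DeltaCon S θ α}

/-- `T^opt_{(A,ρ)} = I_{(A,ρ,ρ⁺)} ∘ Δ♭_{ρ⁺,(ρ:ρ⁺)} ∘ I_{(A,ρ,ρ⁺)}`. -/
def Topt (S : Signature) {A : Type} [SAlg S A] (ρ ρplus : Set (A × A)) :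
    Set (A × A × A × A) :=
  bComp (idBridge ρ ρplus)
    (bComp (deltaFlat S ρplus (centralizer S ρ ρplus)) (idBridge ρ ρplus))

/-- `A` is subdirectly irreducible with monolith `μ`. -/
def IsMonolith (S : Signature) {A : Type} [SAlg S A] (μ : Set (A × A)) : Prop :=
  IsCongruence S μ ∧ μ ≠ diag A ∧ ∀ θ, IsCongruence S θ → θ ≠ diag A → μ ⊆ θ

/-- The carrier of `D(A,θ)`-style quotients: `A(μ)/Δ_{μ,α}`. -/
abbrev DCar (S : Signature) (A : Type) [SAlg S A] (μ α : Set (A × A)) : Type :=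
  Quot (fun p q : ↥μ => ((p : A × A), (q : A × A)) ∈ DeltaCon S μ α)

/-- The class of a pair `p ∈ μ` in `A(μ)/Δ_{μ,α}`. -/
def DCar.mk (S : Signature) (A : Type) [SAlg S A] (μ α : Set (A × A)) (p : ↥μ) :
    DCar S A μ α :=
  Quot.mk _ p

/-- The algebra structure on `A(μ)/Δ_{μ,α}` (extensionally correct when `μ` is a
congruence and `Δ_{μ,α}` is a congruence of `A(μ)`). -/
noncomputable def DAlg (S : Signature) (A : Type) [SAlg S A] (μ α : Set (A × A))
    (h : IsSubuniverse S μ) : SAlg S (DCar S A μ α) :=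
  letI := subAlg μ h
  ⟨fun o x => DCar.mk S A μ α
    (SAlg.interp o fun i => Classical.choose (Quot.exists_rep (x i)))⟩

/-- The canonical similarity bridge `T_{D(A)}` from `A` to `D(A)`. -/
def TDBridge (S : Signature) (A : Type) [SAlg S A] (μ α : Set (A × A)) :
    Set (A × A × DCar S A μ α × DCar S A μ α) :=
  {x | ∃ (a b e : A) (_ : (a, b) ∈ μ) (h1 : (a, e) ∈ μ) (h2 : (b, e) ∈ μ),
    x = (a, b, DCar.mk S A μ α ⟨(a, e), h1⟩, DCar.mk S A μ α ⟨(b, e), h2⟩)}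

/-- Similarity of (subdirectly irreducible) algebras: `D(A) ≅ D(B)`, where `D(X)` is
`X(μ)/Δ_{μ,(0:μ)}` if the monolith `μ` is abelian, and `X` itself otherwise. -/
def SimilarI (S : Signature) {A B : Type} (iA : SAlg S A) (iB : SAlg S B) : Prop :=
  letI := iA
  letI := iB
  ∃ (μA : Set (A × A)) (μB : Set (B × B)) (hA : IsMonolith S μA) (hB : IsMonolith S μB),
    ((Centralizes S μA μA (diag A) ∧ Centralizes S μB μB (diag B)) →
      IsoAlgI (DAlg S A μA (centralizer S (diag A) μA) hA.1.1)
        (DAlg S B μB (centralizer S (diag B) μB) hB.1.1)) ∧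
    ((Centralizes S μA μA (diag A) ∧ ¬ Centralizes S μB μB (diag B)) →
      IsoAlgI (DAlg S A μA (centralizer S (diag A) μA) hA.1.1) iB) ∧
    ((¬ Centralizes S μA μA (diag A) ∧ Centralizes S μB μB (diag B)) →
      IsoAlgI iA (DAlg S B μB (centralizer S (diag B) μB) hB.1.1)) ∧
    ((¬ Centralizes S μA μA (diag A) ∧ ¬ Centralizes S μB μB (diag B)) →
      IsoAlgI iA iB)

end Zhuk

namespace Zhuk

/-- Bridges with matching anchors compose. -/
theorem IsBridgeLR.comp {S : Signature} {A B C : Type} [SAlg S A] [SAlg S B] [SAlg S C]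
    {ρ L : Set (A × A)} {σ M : Set (B × B)} {τ R : Set (C × C)}
    {T : Set (A × A × B × B)} {T' : Set (B × B × C × C)}
    (hT : IsBridgeLR S ρ σ L M T) (hT' : IsBridgeLR S σ τ M R T') :
    IsBridgeLR S ρ τ L R (bComp T T') := by
  obtain ⟨⟨hsub, hl, -, hρ, -, hiff⟩, hL, hM⟩ := hT
  obtain ⟨⟨hsub', -, hr', -, hτ, hiff'⟩, hM', hR⟩ := hT'
  have h12 : pr12 (bComp T T') = pr12 T := by
    ext ⟨a₁, a₂⟩
    constructor
    · rintro ⟨c₁, c₂, b₁, b₂, h, -⟩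
      exact ⟨b₁, b₂, h⟩
    · rintro ⟨b₁, b₂, h⟩
      have hb : (b₁, b₂) ∈ pr12 T' := by
        rw [hM', ← hM]
        exact ⟨a₁, a₂, h⟩
      obtain ⟨c₁, c₂, h'⟩ := hb
      exact ⟨c₁, c₂, b₁, b₂, h, h'⟩
  have h34 : pr34 (bComp T T') = pr34 T' := by
    ext ⟨c₁, c₂⟩
    constructor
    · rintro ⟨a₁, a₂, b₁, b₂, -, h'⟩
      exact ⟨b₁, b₂, h'⟩
    · rintro ⟨b₁, b₂, h'⟩
      have hb : (b₁, b₂) ∈ pr34 T := by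
        rw [hM, ← hM']
        exact ⟨c₁, c₂, h'⟩
      obtain ⟨a₁, a₂, h⟩ := hb
      exact ⟨a₁, a₂, b₁, b₂, h, h'⟩
  refine ⟨⟨?_, ?_, ?_, h12 ▸ hρ, h34 ▸ hτ, ?_⟩, h12.trans hL, h34.trans hR⟩
  · intro o x hx
    choose b₁ b₂ h h' using hx
    exact ⟨SAlg.interp o b₁, SAlg.interp o b₂,
      hsub o (fun i => ((x i).1, (x i).2.1, b₁ i, b₂ i)) h,
      hsub' o (fun i => (b₁ i, b₂ i, (x i).2.2.1, (x i).2.2.2)) h'⟩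
  · rintro a₁ a₂ c₁ c₂ a₁' a₂' ⟨b₁, b₂, h, h'⟩ h₁ h₂
    exact ⟨b₁, b₂, hl _ _ _ _ _ _ h h₁ h₂, h'⟩
  · rintro a₁ a₂ c₁ c₂ c₁' c₂' ⟨b₁, b₂, h, h'⟩ h₁ h₂
    exact ⟨b₁, b₂, h, hr' _ _ _ _ _ _ h' h₁ h₂⟩
  · rintro a₁ a₂ c₁ c₂ ⟨b₁, b₂, hab, hbc⟩
    exact (hiff _ _ _ _ hab).trans (hiff' _ _ _ _ hbc)

/-- The converse of a bridge is a bridge. -/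
theorem IsBridgeLR.conv {S : Signature} {A B : Type} [SAlg S A] [SAlg S B]
    {ρ L : Set (A × A)} {σ R : Set (B × B)} {T : Set (A × A × B × B)}
    (hT : IsBridgeLR S ρ σ L R T) : IsBridgeLR S σ ρ R L (bConv T) := by
  obtain ⟨⟨hsub, hl, hr, hρ, hσ, hiff⟩, hL, hR⟩ := hT
  refine ⟨⟨?_, ?_, ?_, hσ, hρ, ?_⟩, hR, hL⟩
  · intro o x hx
    exact hsub o (fun i => ((x i).2.2.1, (x i).2.2.2, (x i).1, (x i).2.1)) hx
  · intro b₁ b₂ a₁ a₂ b₁' b₂' h h₁ h₂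
    exact hr _ _ _ _ _ _ h h₁ h₂
  · intro b₁ b₂ a₁ a₂ a₁' a₂' h h₁ h₂
    exact hl _ _ _ _ _ _ h h₁ h₂
  · intro b₁ b₂ a₁ a₂ h
    exact (hiff _ _ _ _ h).symm

theorem ReflBridge.conv {A : Type} {T : Set (A × A × A × A)} (hT : ReflBridge T) :
    ReflBridge (bConv T) :=
  hT

theorem ReflBridge.comp {A : Type} {T T' : Set (A × A × A × A)} (hT : ReflBridge T)
    (hT' : ReflBridge T') : ReflBridge (bComp T T') :=
  fun a => ⟨a, a, hT a, hT' a⟩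

theorem ReflBridge.btr_subset_comp_right {A : Type} {T T' : Set (A × A × A × A)}
    (hT : ReflBridge T) : btr T' ⊆ btr (bComp T T') :=
  fun p hp => ⟨p.1, p.1, hT p.1, hp⟩

theorem ReflBridge.btr_subset_comp_left {A : Type} {T T' : Set (A × A × A × A)}
    (hT' : ReflBridge T') : btr T ⊆ btr (bComp T T') :=
  fun p hp => ⟨p.2, p.2, hp, hT' p.2⟩

/-- A maximal member of `ref.tr(ρ,L)` contains every member. -/
theorem IsOptOf.subset_of_mem_refTr {S : Signature} {A : Type} [SAlg S A]
    {ρ L γ δ : Set (A × A)} (hγ : IsOptOf S ρ L γ) (hδ : δ ∈ refTr S ρ L) : δ ⊆ γ := by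
  obtain ⟨⟨U, hU, hUr, rfl⟩, hmax⟩ := hγ
  obtain ⟨V, hV, hVr, rfl⟩ := hδ
  exact hUr.btr_subset_comp_right.trans_eq
    (hmax _ ⟨_, hU.comp hV, hUr.comp hVr, rfl⟩ hVr.btr_subset_comp_left)

/-- Conjugating by a reflexive bridge carries `Opt(σ,R)` into `Opt(ρ,L)`. -/
theorem IsOptOf.subset_of_reflBridge {S : Signature} {A : Type} [SAlg S A]
    {ρ σ L R γ γ' : Set (A × A)} {T : Set (A × A × A × A)}
    (hT : IsBridgeLR S ρ σ L R T) (hTr : ReflBridge T)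
    (hγ : IsOptOf S ρ L γ) (hγ' : IsOptOf S σ R γ') : γ' ⊆ γ := by
  obtain ⟨⟨V, hV, hVr, rfl⟩, -⟩ := hγ'
  have hmem : btr (bComp (bComp T V) (bConv T)) ∈ refTr S ρ L :=
    ⟨_, (hT.comp hV).comp hT.conv, (hTr.comp hVr).comp hTr.conv, rfl⟩
  exact (hTr.btr_subset_comp_right.trans hTr.conv.btr_subset_comp_left).trans
    (hγ.subset_of_mem_refTr hmem)

end Zhuk

/-- a reflexive bridge from `(A,ρ,L)` to `(A,σ,R)` forces
`Opt(ρ,L) = Opt(σ,R)`. -/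
theorem stmt_4 {S : Zhuk.Signature} {A : Type} [Zhuk.SAlg S A] [Finite A]
    (ρ σ L R : Set (A × A))
    (hρ : Zhuk.ConStar S ρ) (hσ : Zhuk.ConStar S σ)
    (hL : L ∈ Zhuk.Cov S ρ) (hR : R ∈ Zhuk.Cov S σ)
    (T : Set (A × A × A × A)) (hT : Zhuk.IsBridgeLR S ρ σ L R T)
    (href : Zhuk.ReflBridge T) :
    ∀ γ γ' : Set (A × A), Zhuk.IsOptOf S ρ L γ → Zhuk.IsOptOf S σ R γ' → γ = γ' := by
  intro γ γ' hγ hγ'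
  exact Set.Subset.antisymm (Zhuk.IsOptOf.subset_of_reflBridge hT.conv href.conv hγ' hγ)
    (Zhuk.IsOptOf.subset_of_reflBridge hT href hγ hγ')
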